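/- Let G be a finite simple graph that is (K₂ ∪ 2K₁)-free, has maximum degree Δ(G) ≥ 9 and chromatic number χ(G) > max{ω(G), Δ(G) − 1}, and has the minimum number of vertices among all (K₂ ∪ 2K₁)-free graphs with these properties. Then ω(G) = Δ(G) − 1, and every vertex lying in a maximum clique of G has degree Δ(G). -/

import Mathlib

open SimpleGraph

/-- The graph `H = P₃ ∪ K₁`: a path 0–1–2 together with the isolated vertex 3. -/
def graphH : SimpleGraph (Fin 4) := SimpleGraph.fromEdgeSet {s(0, 1), s(1, 2)}

/-- The graph `R = K₂ ∪ 2K₁`: the edge 0–1 together with the isolated vertices 2 and 3. -/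
def graphR : SimpleGraph (Fin 4) := SimpleGraph.fromEdgeSet {s(0, 1)}

/-- `G` contains no induced subgraph isomorphic to `F`
(graph embeddings are exactly induced-subgraph copies). -/
def IndFree {α : Type*} {V : Type*} (F : SimpleGraph α) (G : SimpleGraph V) : Prop :=
  IsEmpty (F ↪g G)

/-- Maximum degree `Δ(G)` (with classical decidability of adjacency). -/
noncomputable def maxDeg {V : Type*} [Fintype V] (G : SimpleGraph V) : ℕ := by
  classical exact G.maxDegree

/-- Degree of a vertex (with classical decidability of adjacency). -/
noncomputable def deg {V : Type*} [Fintype V] (G : SimpleGraph V) (v : V) : ℕ := by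
  classical exact G.degree v

section

open Finset
open scoped Classical

namespace SimpleGraph

universe u

variable {V : Type u} {G : SimpleGraph V}

theorem Colorable.succ_of_induce_compl {I : Finset V} {k : ℕ}
    (hI : ∀ a ∈ I, ∀ b ∈ I, ¬ G.Adj a b) (h : (G.induce {v | v ∉ I}).Colorable k) :
    G.Colorable (k + 1) := by
  obtain ⟨C⟩ := h
  have : G.Coloring (Option (Fin k)) :=
    Coloring.mk (fun v => if hv : v ∈ I then none else some (C ⟨v, hv⟩)) (by
      intro a b hab
      by_cases ha : a ∈ I <;> by_cases hb : b ∈ I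
      · exact absurd hab (hI a ha b hb)
      · simp [ha, hb]
      · simp [ha, hb]
      · simp only [ha, hb, dite_false, ne_eq, Option.some.injEq]
        exact C.valid (v := ⟨a, ha⟩) (w := ⟨b, hb⟩) hab)
  simpa using this.colorable

/-- `K₂ ∪ 2K₁`-freeness, spelled out on the four vertices. -/
def EdgeTwoFree (G : SimpleGraph V) : Prop :=
  ∀ a b c d, G.Adj a b → c ≠ d → ¬ G.Adj c d → ¬ G.Adj a c → ¬ G.Adj a d → ¬ G.Adj b c →
    ¬ G.Adj b d → False

theorem EdgeTwoFree.induce (h : G.EdgeTwoFree) (s : Set V) : (G.induce s).EdgeTwoFree :=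
  fun a b c d hab hcd => h a b c d hab fun h => hcd (Subtype.ext h)

/-- `H` has a matching with `k` edges `x i`–`y i`. -/
def HasMatching (H : SimpleGraph V) (k : ℕ) : Prop :=
  ∃ x y : Fin k → V, (∀ i, H.Adj (x i) (y i)) ∧ Function.Injective x ∧ Function.Injective y ∧
    ∀ i j, x i ≠ y j

theorem hasMatching_of_fintype {H : SimpleGraph V} {ι : Type*} [Fintype ι] {k : ℕ}
    (hk : Fintype.card ι = k) (x y : ι → V) (hxy : ∀ i, H.Adj (x i) (y i))
    (hx : Function.Injective x) (hy : Function.Injective y) (hne : ∀ i j, x i ≠ y j) :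
    H.HasMatching k := by
  let e := (Fintype.equivFinOfCardEq hk).symm
  exact ⟨x ∘ e, y ∘ e, fun i => hxy _, hx.comp e.injective, hy.comp e.injective,
    fun i j => hne _ _⟩

theorem HasMatching.mono {H : SimpleGraph V} {k l : ℕ} (h : H.HasMatching k) (hl : l ≤ k) :
    H.HasMatching l := by
  obtain ⟨x, y, hxy, hx, hy, hne⟩ := h
  exact ⟨x ∘ Fin.castLE hl, y ∘ Fin.castLE hl, fun i => hxy _,
    hx.comp (Fin.castLE_injective hl), hy.comp (Fin.castLE_injective hl), fun i j => hne _ _⟩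

theorem exists_adj_of_max_indep {I : Finset V} (hI : ∀ a ∈ I, ∀ b ∈ I, ¬ G.Adj a b)
    (hmax : ∀ J : Finset V, (∀ a ∈ J, ∀ b ∈ J, ¬ G.Adj a b) → #J ≤ #I) {v : V} (hv : v ∉ I) :
    ∃ i ∈ I, G.Adj v i := by
  by_contra! hno
  have := hmax (insert v I) (by
    intro a ha b hb
    rcases mem_insert.1 ha with rfl | ha' <;> rcases mem_insert.1 hb with rfl | hb'
    · exact G.irrefl
    · exact hno b hb'
    · exact fun h => hno a ha' h.symm
    · exact hI a ha' b hb')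
  rw [card_insert_of_notMem hv] at this
  omega

theorem hasMatching_succ {H : SimpleGraph V} {k : ℕ} {x y : Fin k → V} {p q : V}
    (hpq : H.Adj p q) (hxy : ∀ i, H.Adj (x i) (y i)) (hx : Function.Injective x)
    (hy : Function.Injective y) (hne : ∀ i j, x i ≠ y j) (hpx : ∀ i, x i ≠ p)
    (hpy : ∀ i, y i ≠ p) (hqx : ∀ i, x i ≠ q) (hqy : ∀ i, y i ≠ q) : H.HasMatching (k + 1) := by
  have hpq' := hpq.ne
  refine hasMatching_of_fintype (ι := Option (Fin k)) (by simp) (fun o => o.elim p x)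
    (fun o => o.elim q y) ?_ ?_ ?_ ?_
  · rintro (_ | i) <;> simp [*]
  · rintro (_ | i) (_ | j) h <;> simp_all [hx.eq_iff, Ne.symm (hpx _)]
  · rintro (_ | i) (_ | j) h <;> simp_all [hy.eq_iff]
  · rintro (_ | i) (_ | j) h <;> simp_all
    exact absurd rfl (hpy j)

theorem EdgeTwoFree.card_le_card_adj (h : G.EdgeTwoFree) {I : Finset V}
    (hI : ∀ a ∈ I, ∀ b ∈ I, ¬ G.Adj a b)
    (hmax : ∀ J : Finset V, (∀ a ∈ J, ∀ b ∈ J, ¬ G.Adj a b) → #J ≤ #I) {v : V} (hv : v ∉ I) :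
    #I ≤ #{i ∈ I | G.Adj v i} + 1 := by
  rw [← card_filter_add_card_filter_not (s := I) (G.Adj v ·)]
  refine Nat.add_le_add_left (card_le_one.2 fun i hi j hj => ?_) _
  by_contra hij
  obtain ⟨l, hl, hvl⟩ := exists_adj_of_max_indep hI hmax hv
  rw [mem_filter] at hi hj
  exact h v l i j hvl hij (hI i hi.1 j hj.1) hi.2 hj.2 (hI l hl i hi.1) (hI l hl j hj.1)

theorem HasMatching.augment_one {H : SimpleGraph V} {k : ℕ} {x y : Fin k → V}
    (hxy : ∀ i, H.Adj (x i) (y i)) (hx : Function.Injective x)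
    (hy : Function.Injective y) (hne : ∀ i j, x i ≠ y j) {u u' : V} (huu : u ≠ u')
    (hux : ∀ i, x i ≠ u) (huy : ∀ i, y i ≠ u) (hux' : ∀ i, x i ≠ u') (huy' : ∀ i, y i ≠ u')
    {i : Fin k} (hi : H.Adj u (x i)) (hi' : H.Adj u' (y i)) : H.HasMatching (k + 1) := by
  refine hasMatching_succ (x := Function.update x i u) (y := Function.update y i (x i)) hi'
    ?_ ?_ ?_ ?_ ?_ ?_ ?_ ?_ <;> simp only [Function.Injective, Function.update_apply] at * <;> grind

theorem HasMatching.augment_two {H : SimpleGraph V} {k : ℕ} {x y : Fin k → V}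
    (hxy : ∀ i, H.Adj (x i) (y i)) (hx : Function.Injective x)
    (hy : Function.Injective y) (hne : ∀ i j, x i ≠ y j) {u u' : V} (huu : u ≠ u')
    (hux : ∀ i, x i ≠ u) (huy : ∀ i, y i ≠ u) (hux' : ∀ i, x i ≠ u') (huy' : ∀ i, y i ≠ u')
    {i j : Fin k} (hij : i ≠ j) (hi : H.Adj u (x i)) (hj : H.Adj u' (x j))
    (hyy : H.Adj (y i) (y j)) : H.HasMatching (k + 1) := by
  refine hasMatching_succ (x := Function.update (Function.update x i u) j u')
    (y := Function.update (Function.update y i (x i)) j (x j)) hyy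
    ?_ ?_ ?_ ?_ ?_ ?_ ?_ ?_ <;> simp only [Function.Injective, Function.update_apply] at * <;> grind

theorem HasMatching.augment_three {H : SimpleGraph V} {k : ℕ} {x y : Fin k → V}
    (hxy : ∀ i, H.Adj (x i) (y i)) (hx : Function.Injective x)
    (hy : Function.Injective y) (hne : ∀ i j, x i ≠ y j) {u u' : V} (huu : u ≠ u')
    (hux : ∀ i, x i ≠ u) (huy : ∀ i, y i ≠ u) (hux' : ∀ i, x i ≠ u') (huy' : ∀ i, y i ≠ u')
    {i j e : Fin k} (hij : i ≠ j) (hie : i ≠ e) (hje : j ≠ e) (hi : H.Adj u (x i))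
    (hj : H.Adj u' (x j)) (hei : H.Adj (x e) (y i)) (hej : H.Adj (y e) (y j)) :
    H.HasMatching (k + 1) := by
  refine hasMatching_succ (x := Function.update (Function.update x i u) j u')
    (y := Function.update (Function.update (Function.update y i (x i)) j (x j)) e (y i)) hej
    ?_ ?_ ?_ ?_ ?_ ?_ ?_ ?_ <;> simp only [Function.Injective, Function.update_apply] at * <;> grind

variable [Fintype V]

/-- The neighbours of a vertex, as a finset. -/
noncomputable def nbrs (G : SimpleGraph V) (v : V) : Finset V := {w | G.Adj v w}

theorem mem_nbrs {v w : V} : w ∈ G.nbrs v ↔ G.Adj v w := by simp [nbrs]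

theorem exists_max_indep (G : SimpleGraph V) :
    ∃ I : Finset V, (∀ a ∈ I, ∀ b ∈ I, ¬ G.Adj a b) ∧
      ∀ J : Finset V, (∀ a ∈ J, ∀ b ∈ J, ¬ G.Adj a b) → #J ≤ #I := by
  obtain ⟨I, hI, hmax⟩ := Finset.exists_max_image
    (univ.filter fun I : Finset V => ∀ a ∈ I, ∀ b ∈ I, ¬ G.Adj a b) card ⟨∅, by simp⟩
  exact ⟨I, by simpa using hI, fun J hJ => hmax J (by simpa using hJ)⟩

theorem card_adj_induce_add_le {I : Finset V} {c D : ℕ} (hD : ∀ v, #(G.nbrs v) ≤ D)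
    (hc : ∀ v ∉ I, c ≤ #{i ∈ I | G.Adj v i}) (v : {v | v ∉ I}) :
    #((G.induce {v | v ∉ I}).nbrs v) + c ≤ D := by
  refine le_trans ?_ (hD v)
  rw [← card_map (Function.Embedding.subtype _)]
  refine le_trans (Nat.add_le_add_left (hc v v.2) _) ?_
  rw [← card_union_of_disjoint]
  · refine card_le_card fun w => ?_
    simp only [mem_union, mem_map, mem_filter, mem_nbrs]
    rintro (⟨x, hx, rfl⟩ | hw)
    · exact hx
    · exact hw.2
  · rw [Finset.disjoint_left]
    intro w hw hw'
    obtain ⟨x, -, rfl⟩ := mem_map.1 hw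
    exact x.2 (mem_filter.1 hw').1

theorem colorable_succ_of_card_adj_le (D : ℕ) :
    ∀ {V : Type u} [Fintype V] (G : SimpleGraph V), (∀ v, #(G.nbrs v) ≤ D) →
      G.Colorable (D + 1) := by
  induction D with
  | zero =>
    intro V _ G hD
    refine ⟨Coloring.mk (fun _ => 0) fun {a b} hab => ?_⟩
    have := hD a
    rw [nonpos_iff_eq_zero, card_eq_zero] at this
    exact absurd (mem_nbrs.2 hab) (by simp [this])
  | succ D ih =>
    intro V _ G hD
    obtain ⟨I, hI, hmax⟩ := exists_max_indep G
    refine Colorable.succ_of_induce_compl hI (ih _ fun v => ?_)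
    have := card_adj_induce_add_le (c := 1) hD (fun v hv => by
      obtain ⟨i, hi, hvi⟩ := exists_adj_of_max_indep hI hmax hv
      exact card_pos.2 ⟨i, by simp [hi, hvi]⟩) v
    omega

theorem HasMatching.colorable {k : ℕ} (h : Gᶜ.HasMatching k) : G.Colorable (Fintype.card V - k) := by
  obtain ⟨x, y, hxy, hx, hy, hne⟩ := h
  have hC : G.Coloring {v // v ∉ univ.map ⟨y, hy⟩} :=
    Coloring.mk (fun v => if hv : ∃ i, y i = v then ⟨x hv.choose, by simpa using fun i => (hne _ i).symm⟩
      else ⟨v, by simpa using hv⟩) (by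
      intro a b hab heq
      by_cases ha : ∃ i, y i = a <;> by_cases hb : ∃ i, y i = b
      · simp only [ha, hb, dite_true, Subtype.mk.injEq] at heq
        have := hx heq
        rw [← ha.choose_spec, ← hb.choose_spec, this] at hab
        exact G.irrefl hab
      · simp only [ha, hb, dite_true, dite_false, Subtype.mk.injEq] at heq
        have := hxy ha.choose
        rw [ha.choose_spec, heq, compl_adj] at this
        exact this.2 hab.symm
      · simp only [ha, hb, dite_true, dite_false, Subtype.mk.injEq] at heq
        have := hxy hb.choose
        rw [hb.choose_spec, ← heq, compl_adj] at this
        exact this.2 hab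
      · simp only [ha, hb, dite_false, Subtype.mk.injEq] at heq
        exact G.ne_of_adj hab heq)
  convert hC.colorable
  rw [Fintype.card_subtype_compl, Fintype.card_coe, card_map, card_univ, Fintype.card_fin]

theorem exists_indep_of_cover {H : SimpleGraph V} {k : ℕ} {x y : Fin k → V}
    (hyy : ∀ i j, ¬ H.Adj (y i) (y j))
    (huy : ∀ u, (∀ i, x i ≠ u) → (∀ i, y i ≠ u) → ∀ i, ¬ H.Adj u (y i))
    (huu : ∀ u u', (∀ i, x i ≠ u) → (∀ i, y i ≠ u) → (∀ i, x i ≠ u') → (∀ i, y i ≠ u') →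
      ¬ H.Adj u u') :
    ∃ s : Finset V, (∀ a ∈ s, ∀ b ∈ s, ¬ H.Adj a b) ∧ Fintype.card V ≤ #s + k := by
  refine ⟨(univ.image x)ᶜ, fun a ha b hb hab => ?_, ?_⟩
  · simp only [mem_compl, mem_image, mem_univ, true_and, not_exists] at ha hb
    by_cases ha' : ∃ i, y i = a <;> by_cases hb' : ∃ i, y i = b
    · obtain ⟨i, rfl⟩ := ha'
      obtain ⟨j, rfl⟩ := hb'
      exact hyy i j hab
    · obtain ⟨i, rfl⟩ := ha'
      exact huy b hb (by simpa using hb') i hab.symm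
    · obtain ⟨i, rfl⟩ := hb'
      exact huy a ha (by simpa using ha') i hab
    · exact huu a b ha (by simpa using ha') hb (by simpa using hb') hab
  · have h1 : #(univ.image x) ≤ k := card_image_le.trans (by simp)
    have h2 := card_compl_add_card (univ.image x)
    omega

/-- An unmatched vertex is adjacent to an end of all but `k - δ` matching edges. -/
theorem adj_or_adj_of_unmatched {H : SimpleGraph V} {δ k : ℕ} {x y : Fin k → V}
    (hδ : ∀ v, δ ≤ #(H.nbrs v)) (hk : k ≤ δ + 1) {u : V} (huy : ∀ i, ¬ H.Adj u (y i))
    (huu : ∀ u', (∀ i, x i ≠ u') → (∀ i, y i ≠ u') → ¬ H.Adj u u')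
    {i j : Fin k} (hij : i ≠ j) : H.Adj u (x i) ∨ H.Adj u (x j) := by
  by_contra! hno
  have hsub : H.nbrs u ⊆ ((univ.erase i).erase j).image x := by
    intro w hw
    rw [mem_nbrs] at hw
    by_contra hw'
    simp only [mem_image, mem_erase, mem_univ, and_true, not_exists, not_and] at hw'
    refine huu w (fun l hl => ?_) (fun l hl => huy l (hl ▸ hw)) hw
    refine hw' l ⟨?_, ?_⟩ hl <;> rintro rfl
    · exact hno.2 (hl ▸ hw)
    · exact hno.1 (hl ▸ hw)
  have h1 := (hδ u).trans ((card_le_card hsub).trans card_image_le)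
  rw [card_erase_of_mem (by simp [hij.symm]), card_erase_of_mem (mem_univ _), card_univ,
    Fintype.card_fin] at h1
  have := i.2
  have := j.2
  have := Fin.val_ne_of_ne hij
  omega

theorem exists_two_unmatched {k : ℕ} (x y : Fin k → V) (hn : 2 * k + 2 ≤ Fintype.card V) :
    ∃ u u', u ≠ u' ∧ (∀ i, x i ≠ u) ∧ (∀ i, y i ≠ u) ∧ (∀ i, x i ≠ u') ∧ ∀ i, y i ≠ u' := by
  have h1 : #(univ.image x) ≤ k := card_image_le.trans (by simp)
  have h2 : #(univ.image y) ≤ k := card_image_le.trans (by simp)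
  have h3 := card_union_le (univ.image x) (univ.image y)
  have h4 := card_compl_add_card (univ.image x ∪ univ.image y)
  obtain ⟨u, hu, u', hu', huu⟩ := one_lt_card.1
    (show 1 < #(univ.image x ∪ univ.image y)ᶜ by omega)
  simp only [mem_compl, mem_union, mem_image, mem_univ, true_and, not_or, not_exists] at hu hu'
  exact ⟨u, u', huu, hu.1, hu.2, hu'.1, hu'.2⟩

theorem exists_indep_of_oriented {H : SimpleGraph V} {δ k : ℕ} {x y : Fin k → V}
    (htri : ∀ a b c, H.Adj a b → H.Adj b c → ¬ H.Adj a c)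
    (hδ : ∀ v, δ ≤ #(H.nbrs v)) (hk : k ≤ δ + 1) (hmax : ¬ H.HasMatching (k + 1))
    (hn : 2 * k + 2 ≤ Fintype.card V)
    (hxy : ∀ i, H.Adj (x i) (y i)) (hx : Function.Injective x)
    (hy : Function.Injective y) (hne : ∀ i j, x i ≠ y j)
    (huy : ∀ u, (∀ i, x i ≠ u) → (∀ i, y i ≠ u) → ∀ i, ¬ H.Adj u (y i)) :
    ∃ s : Finset V, (∀ a ∈ s, ∀ b ∈ s, ¬ H.Adj a b) ∧ Fintype.card V ≤ #s + k := by
  have huu : ∀ u u', (∀ i, x i ≠ u) → (∀ i, y i ≠ u) → (∀ i, x i ≠ u') → (∀ i, y i ≠ u') →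
      ¬ H.Adj u u' := fun u u' h1 h2 h3 h4 h =>
    hmax (hasMatching_succ h hxy hx hy hne h1 h2 h3 h4)
  obtain ⟨u₀, u₁, h01, hx0, hy0, hx1, hy1⟩ := exists_two_unmatched x y hn
  have key : ∀ u, (∀ i, x i ≠ u) → (∀ i, y i ≠ u) → ∀ i j, i ≠ j →
      H.Adj u (x i) ∨ H.Adj u (x j) := fun u h1 h2 i j hij =>
    adj_or_adj_of_unmatched hδ hk (huy u h1 h2) (fun u' => huu u u' h1 h2) hij
  have haug : ∀ u u', u ≠ u' → (∀ i, x i ≠ u) → (∀ i, y i ≠ u) → (∀ i, x i ≠ u') →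
      (∀ i, y i ≠ u') → ∀ i j, i ≠ j → H.Adj u (x i) → H.Adj u' (x j) → ¬ H.Adj (y i) (y j) :=
    fun u u' h a b c d i j hij hi hj hyy =>
      hmax (HasMatching.augment_two hxy hx hy hne h a b c d hij hi hj hyy)
  have hyy : ∀ i j u u', (∀ i, x i ≠ u) → (∀ i, y i ≠ u) → (∀ i, x i ≠ u') →
      (∀ i, y i ≠ u') → H.Adj u (x i) → H.Adj u' (x j) → ¬ H.Adj (y i) (y j) := by
    intro i j u u' h1 h2 h3 h4 hi hj hadj
    have hij : i ≠ j := by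
      rintro rfl
      exact H.irrefl hadj
    have k0 := key u₀ hx0 hy0 i j hij
    have k1 := key u₁ hx1 hy1 i j hij
    have a1 := fun v w hvw a b c d hv hw => haug v w hvw a b c d i j hij hv hw hadj
    have huu' : u = u' := by_contra fun h => a1 u u' h h1 h2 h3 h4 hi hj
    subst huu'
    have h0 : u₀ = u := by_contra fun h => k0.elim
      (fun h' => a1 u₀ u h hx0 hy0 h1 h2 h' hj) (fun h' => a1 u u₀ (Ne.symm h) h1 h2 hx0 hy0 hi h')
    have h1' : u₁ = u := by_contra fun h => k1.elim
      (fun h' => a1 u₁ u h hx1 hy1 h1 h2 h' hj) (fun h' => a1 u u₁ (Ne.symm h) h1 h2 hx1 hy1 hi h')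
    exact h01 (h0.trans h1'.symm)
  by_cases hall : ∀ i, ∃ u, (∀ i, x i ≠ u) ∧ (∀ i, y i ≠ u) ∧ H.Adj u (x i)
  · refine exists_indep_of_cover (x := x) (y := y) (fun i j => ?_) huy huu
    obtain ⟨u, a, b, hi⟩ := hall i
    obtain ⟨u', c, d, hj⟩ := hall j
    exact hyy i j u u' a b c d hi hj
  push Not at hall
  obtain ⟨e, he⟩ := hall
  have hadj : ∀ u, (∀ i, x i ≠ u) → (∀ i, y i ≠ u) → ∀ i, i ≠ e → H.Adj u (x i) :=
    fun u a b i hie => (key u a b i e hie).resolve_right (he u a b)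
  have hyy' : ∀ i j, i ≠ e → j ≠ e → ¬ H.Adj (y i) (y j) := fun i j hi hj =>
    hyy i j u₀ u₀ hx0 hy0 hx0 hy0 (hadj u₀ hx0 hy0 i hi) (hadj u₀ hx0 hy0 j hj)
  by_cases hye : ∀ j, j ≠ e → ¬ H.Adj (y e) (y j)
  · refine exists_indep_of_cover (x := x) (y := y) (fun i j hij => ?_) huy huu
    by_cases hi : i = e
    · subst hi
      by_cases hj : j = i
      · exact hij.ne (by rw [hj])
      · exact hye j hj hij
    · by_cases hj : j = e
      · subst hj
        exact hye i hi hij.symm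
      · exact hyy' i j hi hj hij
  push Not at hye
  obtain ⟨j, hje, hej⟩ := hye
  have hxe : ∀ i, i ≠ e → ¬ H.Adj (x e) (y i) := by
    intro i hie hei
    by_cases hij : i = j
    · subst hij
      exact htri _ _ _ (hxy e) hej hei
    · exact hmax (HasMatching.augment_three hxy hx hy hne h01 hx0 hy0 hx1 hy1 hij hie hje
        (hadj _ hx0 hy0 i hie) (hadj _ hx1 hy1 j hje) hei hej)
  have hU : ∀ u, (∀ i, Function.update x e (y e) i ≠ u) →
      (∀ i, Function.update y e (x e) i ≠ u) → (∀ i, x i ≠ u) ∧ (∀ i, y i ≠ u) := by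
    intro u h1 h2
    simp only [Function.update_apply] at h1 h2
    grind
  refine exists_indep_of_cover (x := Function.update x e (y e)) (y := Function.update y e (x e))
    (fun i j hij => ?_) (fun u h1 h2 i hi => ?_) (fun u u' h1 h2 h3 h4 => ?_)
  · simp only [Function.update_apply] at hij
    split_ifs at hij with hi hj hj
    · exact H.irrefl hij
    · exact hxe j hj hij
    · exact hxe i hi hij.symm
    · exact hyy' i j hi hj hij
  · obtain ⟨h1, h2⟩ := hU u h1 h2
    simp only [Function.update_apply] at hi
    split_ifs at hi with h
    · exact he u h1 h2 hi
    · exact huy u h1 h2 i hi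
  · obtain ⟨h1, h2⟩ := hU u h1 h2
    obtain ⟨h3, h4⟩ := hU u' h3 h4
    exact huu u u' h1 h2 h3 h4

theorem exists_indep_of_two_unmatched {H : SimpleGraph V} {δ k : ℕ}
    (htri : ∀ a b c, H.Adj a b → H.Adj b c → ¬ H.Adj a c)
    (hδ : ∀ v, δ ≤ #(H.nbrs v)) (hk : k ≤ δ + 1) (hmat : H.HasMatching k)
    (hmax : ¬ H.HasMatching (k + 1)) (hn : 2 * k + 2 ≤ Fintype.card V) :
    ∃ s : Finset V, (∀ a ∈ s, ∀ b ∈ s, ¬ H.Adj a b) ∧ Fintype.card V ≤ #s + k := by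
  obtain ⟨x, y, hxy, hx, hy, hne⟩ := hmat
  obtain ⟨P, hP⟩ : ∃ P : Fin k → Prop, ∀ i, P i ↔
      ∃ u, (∀ i, x i ≠ u) ∧ (∀ i, y i ≠ u) ∧ H.Adj u (y i) := ⟨_, fun _ => Iff.rfl⟩
  have hU : ∀ u, (∀ i, (if P i then y i else x i) ≠ u) → (∀ i, (if P i then x i else y i) ≠ u) →
      (∀ i, x i ≠ u) ∧ (∀ i, y i ≠ u) := by
    refine fun u h1 h2 => ⟨fun i => ?_, fun i => ?_⟩ <;> by_cases h : P i
    · simpa [h] using h2 i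
    · simpa [h] using h1 i
    · simpa [h] using h1 i
    · simpa [h] using h2 i
  have hne' := fun i j => (hne i j).symm
  refine exists_indep_of_oriented (x := fun i => if P i then y i else x i)
    (y := fun i => if P i then x i else y i) htri hδ hk hmax hn (fun i => ?_) (fun i j h => ?_)
    (fun i j h => ?_) (fun i j => ?_) (fun u h1 h2 i hi => ?_)
  · by_cases h : P i
    · simpa [h] using (hxy i).symm
    · simpa [h] using hxy i
  · by_cases hi : P i <;> by_cases hj : P j <;>
      simpa [hi, hj, hne, hne', hx.eq_iff, hy.eq_iff] using h
  · by_cases hi : P i <;> by_cases hj : P j <;>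
      simpa [hi, hj, hne, hne', hx.eq_iff, hy.eq_iff] using h
  · by_cases hij : i = j
    · subst hij
      by_cases hi : P i <;> simp [hi, hne, hne']
    · by_cases hi : P i <;> by_cases hj : P j <;> 
        simp [hi, hj, hne, hne', hx.eq_iff, hy.eq_iff, hij]
  · obtain ⟨h1, h2⟩ := hU u h1 h2
    by_cases h : P i
    · obtain ⟨u', h1', h2', hu'⟩ := (hP i).1 h
      simp only [h, if_true] at hi
      by_cases huu : u = u'
      · subst huu
        exact htri _ _ _ hi (hxy i) hu'
      · exact hmax (HasMatching.augment_one hxy hx hy hne huu h1 h2 h1' h2' hi hu')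
    · simp only [h, if_false] at hi
      exact h ((hP i).2 ⟨u, h1, h2, hi⟩)

theorem five_mul_le_of_five_cycle {H : SimpleGraph V} {δ : ℕ}
    (htri : ∀ a b c, H.Adj a b → H.Adj b c → ¬ H.Adj a c)
    (hδ : ∀ v, δ ≤ #(H.nbrs v)) {a p v q b : V} (hap : H.Adj a p) (hpv : H.Adj p v)
    (hvq : H.Adj v q) (hqb : H.Adj q b) (hba : H.Adj b a) : 5 * δ ≤ 2 * Fintype.card V := by
  have hsum : #(H.nbrs a) + #(H.nbrs p) + #(H.nbrs v) + #(H.nbrs q) + #(H.nbrs b) ≤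
      ∑ _w : V, 2 := by
    simp only [nbrs, card_filter, ← sum_add_distrib]
    refine sum_le_sum fun w _ => ?_
    have h1 : ¬ (H.Adj a w ∧ H.Adj p w) := fun h => htri _ _ _ hap h.2 h.1
    have h2 : ¬ (H.Adj p w ∧ H.Adj v w) := fun h => htri _ _ _ hpv h.2 h.1
    have h3 : ¬ (H.Adj v w ∧ H.Adj q w) := fun h => htri _ _ _ hvq h.2 h.1
    have h4 : ¬ (H.Adj q w ∧ H.Adj b w) := fun h => htri _ _ _ hqb h.2 h.1
    have h5 : ¬ (H.Adj b w ∧ H.Adj a w) := fun h => htri _ _ _ hba h.2 h.1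
    split_ifs <;> first | omega | tauto
  have := hδ a
  have := hδ p
  have := hδ v
  have := hδ q
  have := hδ b
  simp only [sum_const, card_univ, smul_eq_mul] at hsum
  omega

theorem disjoint_nbrs {H : SimpleGraph V}
    (htri : ∀ a b c, H.Adj a b → H.Adj b c → ¬ H.Adj a c) {a b : V} (hab : H.Adj a b) :
    Disjoint (H.nbrs a) (H.nbrs b) := by
  rw [Finset.disjoint_left]
  intro w hw hw'
  exact htri a b w hab (mem_nbrs.1 hw') (mem_nbrs.1 hw)

theorem exists_bipartition {H : SimpleGraph V} {δ : ℕ}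
    (htri : ∀ a b c, H.Adj a b → H.Adj b c → ¬ H.Adj a c)
    (hδ : ∀ v, δ ≤ #(H.nbrs v)) (h7 : 7 ≤ δ) (hn : Fintype.card V ≤ 2 * δ + 3) :
    ∃ P : Finset V, (∀ a ∈ P, ∀ b ∈ P, ¬ H.Adj a b) ∧ ∀ a ∉ P, ∀ b ∉ P, ¬ H.Adj a b := by
  rcases isEmpty_or_nonempty V with _ | ⟨⟨a⟩⟩
  · exact ⟨∅, by simp, fun a => isEmptyElim a⟩
  obtain ⟨b, hb⟩ := card_pos.1 (show 0 < #(H.nbrs a) by have := hδ a; omega)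
  rw [mem_nbrs] at hb
  have hindep : ∀ p v w, (∀ q, H.Adj p q → ¬ H.Adj v q) → (∀ q, H.Adj p q → ¬ H.Adj w q) →
      ¬ H.Adj v w := by
    intro p v w hv hw hvw
    have h1 : Disjoint (H.nbrs v ∪ H.nbrs w) (H.nbrs p) := by
      rw [Finset.disjoint_left]
      intro q hq hq'
      rw [mem_union, mem_nbrs, mem_nbrs] at hq
      rw [mem_nbrs] at hq'
      exact hq.elim (hv q hq') (hw q hq')
    have h2 := card_le_univ (H.nbrs v ∪ H.nbrs w ∪ H.nbrs p)
    rw [card_union_of_disjoint h1, card_union_of_disjoint (disjoint_nbrs htri hvw)] at h2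
    have := hδ v
    have := hδ w
    have := hδ p
    omega
  have hcyc : ∀ v p q, H.Adj a p → H.Adj v p → H.Adj b q → ¬ H.Adj v q := by
    intro v p q hap hvp hbq hvq
    have := five_mul_le_of_five_cycle htri hδ hap hvp.symm hvq hbq.symm hb.symm
    omega
  refine ⟨univ.filter fun v => ∀ q, H.Adj a q → ¬ H.Adj v q, fun v hv w hw => ?_,
    fun v hv w hw => ?_⟩
  · simp only [mem_filter, mem_univ, true_and] at hv hw
    exact hindep a v w hv hw
  · simp only [mem_filter, mem_univ, true_and, not_forall, not_not] at hv hw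
    obtain ⟨p, hap, hvp⟩ := hv
    obtain ⟨p', hap', hwp⟩ := hw
    exact hindep b v w (fun q hq => hcyc v p q hap hvp hq) (fun q hq => hcyc w p' q hap' hwp hq)

theorem exists_matching_indep_of_bipartition {H : SimpleGraph V} {δ : ℕ}
    (hδ : ∀ v, δ ≤ #(H.nbrs v)) (h7 : 7 ≤ δ) (hn : Fintype.card V ≤ 2 * δ + 3)
    {P : Finset V} (hP : ∀ a ∈ P, ∀ b ∈ P, ¬ H.Adj a b) (hP' : ∀ a ∉ P, ∀ b ∉ P, ¬ H.Adj a b)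
    (hle : #P ≤ #Pᶜ) :
    ∃ k, ∃ s : Finset V, H.HasMatching k ∧ (∀ a ∈ s, ∀ b ∈ s, ¬ H.Adj a b) ∧
      Fintype.card V ≤ #s + k := by
  have hcard := card_compl_add_card P
  have hall : ∀ S : Finset {v // v ∈ P}, #S ≤ #(S.biUnion fun v => H.nbrs v) := by
    intro S
    rcases S.eq_empty_or_nonempty with rfl | ⟨v, hv⟩
    · simp
    have h1 : #(H.nbrs v) ≤ #(S.biUnion fun v => H.nbrs v) :=
      card_le_card (subset_biUnion_of_mem (fun v : {v // v ∈ P} => H.nbrs v) hv)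
    have h2 := hδ v
    have h3 : #S ≤ #P := by simpa using card_le_univ S
    by_cases hS : #S ≤ δ
    · omega
    have hSu : S = univ := eq_univ_of_card S (by rw [Fintype.card_coe]; omega)
    refine h3.trans (hle.trans (card_le_card fun w hw => ?_))
    obtain ⟨q, hq⟩ := card_pos.1 (show 0 < #(H.nbrs w) by have := hδ w; omega)
    rw [mem_nbrs] at hq
    have hqP : q ∈ P := by
      by_contra hqP
      exact hP' w (mem_compl.1 hw) q hqP hq
    exact mem_biUnion.2 ⟨⟨q, hqP⟩, by simp [hSu], mem_nbrs.2 hq.symm⟩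
  obtain ⟨f, hf, hft⟩ := (all_card_le_biUnion_card_iff_exists_injective _).1 hall
  simp only [mem_nbrs] at hft
  refine ⟨#P, Pᶜ, hasMatching_of_fintype (ι := {v // v ∈ P}) (by simp) Subtype.val f hft
    Subtype.val_injective hf (fun i j hij => ?_), fun a ha b hb => hP' a (mem_compl.1 ha) b
    (mem_compl.1 hb), hcard.ge⟩
  exact hP j j.2 i i.2 (hij ▸ hft j)

theorem exists_matching_indep_of_small {H : SimpleGraph V} {δ : ℕ}
    (htri : ∀ a b c, H.Adj a b → H.Adj b c → ¬ H.Adj a c)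
    (hδ : ∀ v, δ ≤ #(H.nbrs v)) (h7 : 7 ≤ δ) (hn : Fintype.card V ≤ 2 * δ + 3) :
    ∃ k, ∃ s : Finset V, H.HasMatching k ∧ (∀ a ∈ s, ∀ b ∈ s, ¬ H.Adj a b) ∧
      Fintype.card V ≤ #s + k := by
  obtain ⟨P, hP, hP'⟩ := exists_bipartition htri hδ h7 hn
  rcases le_total #P #Pᶜ with hle | hle
  · exact exists_matching_indep_of_bipartition hδ h7 hn hP hP' hle
  · exact exists_matching_indep_of_bipartition (P := Pᶜ) hδ h7 hn (by simpa using hP')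
      (by simpa using hP) (by simpa using hle)

/-- A triangle-free graph whose matching number is at most one above its minimum degree has
the König property, apart from graphs of small order. -/
theorem exists_matching_indep {H : SimpleGraph V} {δ m : ℕ}
    (htri : ∀ a b c, H.Adj a b → H.Adj b c → ¬ H.Adj a c)
    (hδ : ∀ v, δ ≤ #(H.nbrs v)) (hm : m ≤ δ + 1) (hmax : ¬ H.HasMatching (m + 1))
    (hn : Fintype.card V ≤ 2 * m + 1 → 7 ≤ δ) :
    ∃ k, ∃ s : Finset V, H.HasMatching k ∧ (∀ a ∈ s, ∀ b ∈ s, ¬ H.Adj a b) ∧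
      Fintype.card V ≤ #s + k := by
  obtain ⟨k, hk, hk'⟩ : ∃ k, H.HasMatching k ∧ ¬ H.HasMatching (k + 1) := by
    by_contra! hno
    have hall : ∀ k, H.HasMatching k := by
      intro k
      induction k with
      | zero => exact ⟨Fin.elim0, Fin.elim0, fun i => i.elim0, fun i => i.elim0,
          fun i => i.elim0, fun i => i.elim0⟩
      | succ k ih => exact hno k ih
    exact hmax (hall _)
  have hkm : k ≤ m := by
    by_contra hkm
    exact hmax (hk.mono (by omega))
  by_cases hcard : 2 * k + 2 ≤ Fintype.card V
  · obtain ⟨s, hs, hsc⟩ := exists_indep_of_two_unmatched htri hδ (by omega) hk hk' hcard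
    exact ⟨k, s, hk, hs, hsc⟩
  · exact exists_matching_indep_of_small htri hδ (hn (by omega)) (by omega)

theorem card_nbrs_compl (G : SimpleGraph V) (v : V) :
    #(Gᶜ.nbrs v) + #(G.nbrs v) + 1 = Fintype.card V := by
  have h : Gᶜ.nbrs v = (insert v (G.nbrs v))ᶜ := by
    ext w
    simp [mem_nbrs, eq_comm]
  have h2 := card_compl_add_card (insert v (G.nbrs v))
  rw [card_insert_of_notMem (by simp [mem_nbrs]), ← h] at h2
  omega

theorem exists_clique_of_indep_le_two {D c : ℕ}
    (hα : ∀ J : Finset V, (∀ a ∈ J, ∀ b ∈ J, ¬ G.Adj a b) → #J ≤ 2)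
    (hD : ∀ v, #(G.nbrs v) ≤ D) (hDc : D ≤ c + 1) (hD7 : D + 7 ≤ 2 * c) (hcol : ¬ G.Colorable c) :
    ∃ s : Finset V, G.IsClique s ∧ c + 1 ≤ #s ∧ G.Colorable #s := by
  have hnc : c < Fintype.card V := by
    by_contra hnc
    exact hcol (G.colorable_of_fintype.mono (by omega))
  have hno : ¬ Gᶜ.HasMatching (Fintype.card V - c - 1 + 1) := by
    intro h
    exact hcol (h.colorable.mono (by omega))
  have htri : ∀ a b c, Gᶜ.Adj a b → Gᶜ.Adj b c → ¬ Gᶜ.Adj a c := by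
    intro a b c hab hbc hac
    rw [compl_adj] at hab hbc hac
    have h1 := hα {a, b, c} (by
      have := hab.2
      have := hbc.2
      have := hac.2
      simp [G.adj_comm, *])
    rw [card_eq_three.2 ⟨a, b, c, hab.1, hac.1, hbc.1, rfl⟩] at h1
    omega
  obtain ⟨k, s, hk, hs, hsc⟩ := exists_matching_indep (δ := Fintype.card V - 1 - D)
    (m := Fintype.card V - c - 1) htri (fun v => by
      have := card_nbrs_compl G v
      have := hD v
      omega) (by omega) hno (by omega)
  have hkm : k ≤ Fintype.card V - c - 1 := by
    by_contra hkm
    exact hno (hk.mono (by omega))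
  refine ⟨s, fun a ha b hb hab => ?_, by omega, hk.colorable.mono (by omega)⟩
  have := hs a ha b hb
  rw [compl_adj] at this
  tauto

theorem EdgeTwoFree.colorable_or_exists_clique {D : ℕ} (hf : G.EdgeTwoFree)
    (hD : ∀ v, #(G.nbrs v) ≤ D) (h7 : 7 ≤ D) :
    G.Colorable D ∨ ∃ s : Finset V, G.IsClique s ∧ D + 1 ≤ #s := by
  obtain ⟨I, hI, hmax⟩ := exists_max_indep G
  by_cases h3 : #I ≤ 2
  · by_cases hcol : G.Colorable D
    · exact Or.inl hcol
    · obtain ⟨s, hs, hsc, -⟩ := exists_clique_of_indep_le_two (fun J hJ => (hmax J hJ).trans h3)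
        hD (by omega) (by omega) hcol
      exact Or.inr ⟨s, hs, hsc⟩
  · left
    have h := colorable_succ_of_card_adj_le (D - 2) (G.induce {v | v ∉ I}) fun v => by
      have := card_adj_induce_add_le (c := 2) hD (fun v hv => by
        have := hf.card_le_card_adj hI hmax hv
        omega) v
      omega
    exact (Colorable.succ_of_induce_compl hI h).mono (by omega)

/-- If each vertex outside the independent set `I` has at least two neighbours in `I`, then
double counting bounds the order of `G`. -/
theorem two_mul_card_le {I : Finset V} {D : ℕ} (hD : ∀ v, #(G.nbrs v) ≤ D)
    (h2 : ∀ v ∉ I, 2 ≤ #{i ∈ I | G.Adj v i}) : 2 * (Fintype.card V - #I) ≤ #I * D := by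
  have h := sum_card_bipartiteAbove_eq_sum_card_bipartiteBelow (s := Iᶜ) (t := I) G.Adj
  have hl : ∑ _v ∈ Iᶜ, 2 ≤ ∑ v ∈ Iᶜ, #(I.bipartiteAbove G.Adj v) :=
    sum_le_sum fun v hv => h2 v (mem_compl.1 hv)
  have hr : ∑ i ∈ I, #(Iᶜ.bipartiteBelow G.Adj i) ≤ ∑ _i ∈ I, D :=
    sum_le_sum fun i _ => (card_le_card fun w hw =>
      mem_nbrs.2 (mem_filter.1 hw).2.symm).trans (hD i)
  rw [sum_const, smul_eq_mul, card_compl] at hl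
  rw [sum_const, smul_eq_mul] at hr
  omega

/-- Colour `G` with the vertices of the clique `K` as colours, when the other vertices are those of
an independent set `I` and a small set with no neighbours in `K`. -/
theorem colorable_of_clique_of_indep {I K : Finset V} (hI : ∀ a ∈ I, ∀ b ∈ I, ¬ G.Adj a b)
    (hKI : Disjoint K I) (hn : Fintype.card V ≤ 2 * #K)
    (hK : ∀ v ∈ K, #I ≤ #{i ∈ I | G.Adj v i} + 1) (hKW : ∀ v ∈ K, ∀ w ∉ K, w ∉ I → ¬ G.Adj v w)
    (hIK : ∀ i ∈ I, ∃ v ∈ K, ¬ G.Adj i v) : G.Colorable #K := by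
  choose! g hgK hg using hIK
  have hginj : ∀ i ∈ I, ∀ j ∈ I, g i = g j → i = j := by
    intro i hi j hj hij
    have h1 := hK (g i) (hgK i hi)
    rw [← card_filter_add_card_filter_not (s := I) (G.Adj (g i) ·)] at h1
    refine card_le_one.1 (show #{a ∈ I | ¬ G.Adj (g i) a} ≤ 1 by omega) i ?_ j ?_
    · exact mem_filter.2 ⟨hi, fun h => hg i hi h.symm⟩
    · exact mem_filter.2 ⟨hj, fun h => hg j hj (hij ▸ h.symm)⟩
  have hgI : #(I.image g) = #I := card_image_of_injOn fun i hi j hj => hginj i hi j hj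
  have hsub : I.image g ⊆ K := image_subset_iff.2 hgK
  have hcard : #(K ∪ I)ᶜ ≤ #(K \ I.image g) := by
    have h1 := card_compl_add_card (K ∪ I)
    rw [card_union_of_disjoint hKI] at h1
    have h2 := card_sdiff_add_card_eq_card hsub
    omega
  obtain ⟨f⟩ : Nonempty ({v // v ∈ (K ∪ I)ᶜ} ↪ {v // v ∈ K \ I.image g}) :=
    Function.Embedding.nonempty_of_card_le (by simpa only [Fintype.card_coe] using hcard)
  have hW : ∀ {v}, v ∉ K → v ∉ I → v ∈ (K ∪ I)ᶜ := fun h h' => by simp [h, h']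
  let c : V → V := fun v => if hv : v ∈ K then v else if hv' : v ∈ I then g v else
    f ⟨v, hW hv hv'⟩
  have hcK : ∀ v ∈ K, c v = v := fun v hv => by simp [c, hv]
  have hcI : ∀ v ∈ I, c v = g v := fun v hv => by
    simp [c, hv, Finset.disjoint_right.1 hKI hv]
  have hcW : ∀ v (hv : v ∉ K) (hv' : v ∉ I), c v = f ⟨v, hW hv hv'⟩ := fun v hv hv' => by
    simp [c, hv, hv']
  have hfK : ∀ w, (f w : V) ∈ K ∧ ∀ i ∈ I, g i ≠ f w := fun w => by
    have := (f w).2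
    rw [mem_sdiff, mem_image] at this
    exact ⟨this.1, fun i hi h => this.2 ⟨i, hi, h⟩⟩
  have hcmem : ∀ v, c v ∈ K := by
    intro v
    by_cases hv : v ∈ K
    · rwa [hcK v hv]
    by_cases hv' : v ∈ I
    · rw [hcI v hv']
      exact hgK v hv'
    · rw [hcW v hv hv']
      exact (hfK _).1
  have hvalid : ∀ a b, G.Adj a b → (a ∈ K ∨ a ∈ I ∧ b ∉ K ∨ b ∉ K ∧ b ∉ I) → c a ≠ c b := by
    intro a b hab hcase heq
    by_cases ha : a ∈ K
    · rw [hcK a ha] at heq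
      by_cases hb : b ∈ K
      · rw [hcK b hb] at heq
        exact hab.ne heq
      by_cases hb' : b ∈ I
      · rw [hcI b hb'] at heq
        exact hg b hb' (heq ▸ hab.symm)
      · exact hKW a ha b hb hb' hab
    have hb : b ∉ K := by tauto
    by_cases ha' : a ∈ I
    · rw [hcI a ha'] at heq
      by_cases hb' : b ∈ I
      · exact hI a ha' b hb' hab
      · rw [hcW b hb hb'] at heq
        exact (hfK _).2 a ha' heq
    · have hb' : b ∉ I := by tauto
      rw [hcW a ha ha', hcW b hb hb'] at heq
      exact hab.ne (congrArg Subtype.val (f.injective (Subtype.ext heq)))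
  have hC : G.Coloring {v // v ∈ K} := Coloring.mk (fun v => ⟨c v, hcmem v⟩) (by
    intro a b hab heq
    have heq := congrArg Subtype.val heq
    by_cases h : a ∈ K ∨ a ∈ I ∧ b ∉ K ∨ b ∉ K ∧ b ∉ I
    · exact hvalid a b hab h heq
    · exact hvalid b a hab.symm (by tauto) heq.symm)
  simpa using hC.colorable

/-- `K₂ ∪ 2K₁`-free graphs satisfy the Borodin–Kostochka bound. -/
theorem EdgeTwoFree.colorable_pred_or_exists_clique {D : ℕ} (hf : G.EdgeTwoFree)
    (hD : ∀ v, #(G.nbrs v) ≤ D) (h9 : 9 ≤ D) :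
    G.Colorable (D - 1) ∨ ∃ s : Finset V, G.IsClique s ∧ G.Colorable #s := by
  by_contra! hno
  obtain ⟨hcol, hcl⟩ := hno
  obtain ⟨I, hI, hmax⟩ := exists_max_indep G
  by_cases h3 : #I ≤ 2
  · obtain ⟨s, hs, -, hsc⟩ := exists_clique_of_indep_le_two (c := D - 1)
      (fun J hJ => (hmax J hJ).trans h3) hD (by omega) (by omega) hcol
    exact hcl s hs hsc
  have hIadj : ∀ v ∉ I, #I ≤ #{i ∈ I | G.Adj v i} + 1 := fun v hv =>
    hf.card_le_card_adj hI hmax hv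
  have h2 : ∀ v ∉ I, 2 ≤ #{i ∈ I | G.Adj v i} := fun v hv => by
    have := hIadj v hv
    omega
  have hD' : ∀ v, #((G.induce {v | v ∉ I}).nbrs v) ≤ D - 2 := fun v => by
    have := card_adj_induce_add_le hD h2 v
    omega
  have hcolD : G.Colorable D :=
    (Colorable.succ_of_induce_compl hI (colorable_succ_of_card_adj_le _ _ hD')).mono (by omega)
  rcases (hf.induce {v | v ∉ I}).colorable_or_exists_clique hD' (by omega) with h | ⟨s, hs, hsc⟩
  · exact hcol ((Colorable.succ_of_induce_compl hI h).mono (by omega))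
  obtain ⟨K, hKI, hK, hKc⟩ : ∃ K : Finset V, Disjoint K I ∧ G.IsClique K ∧ D - 1 ≤ #K := by
    refine ⟨s.map (Function.Embedding.subtype _), ?_, ?_, by rw [card_map]; omega⟩
    · rw [Finset.disjoint_left]
      intro v hv hvI
      obtain ⟨x, -, rfl⟩ := mem_map.1 hv
      exact x.2 hvI
    · intro a ha b hb hab
      obtain ⟨x, hx, rfl⟩ := mem_map.1 (mem_coe.1 ha)
      obtain ⟨y, hy, rfl⟩ := mem_map.1 (mem_coe.1 hb)
      exact hs hx hy fun h => hab (by rw [h])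
  have hKI' : ∀ v ∈ K, v ∉ I := fun v hv => Finset.disjoint_left.1 hKI hv
  have hsub : ∀ v ∈ K, K.erase v ∪ I.filter (G.Adj v ·) ⊆ G.nbrs v := by
    intro v hv w hw
    rw [mem_nbrs]
    rcases mem_union.1 hw with hw | hw
    · exact hK hv (mem_of_mem_erase hw) (ne_of_mem_erase hw).symm
    · exact (mem_filter.1 hw).2
  have hcardU : ∀ v ∈ K, #(K.erase v ∪ I.filter (G.Adj v ·)) =
      #K - 1 + #{i ∈ I | G.Adj v i} := by
    intro v hv
    rw [card_union_of_disjoint, card_erase_of_mem hv]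
    exact Finset.disjoint_of_subset_left (erase_subset _ _)
      (Finset.disjoint_of_subset_right (filter_subset _ _) hKI)
  obtain ⟨v₀, hv₀⟩ := card_pos.1 (show 0 < #K by omega)
  have hcards : #K = D - 1 ∧ #I = 3 := by
    have h4 := card_le_card (hsub v₀ hv₀)
    rw [hcardU v₀ hv₀] at h4
    have := hIadj v₀ (hKI' v₀ hv₀)
    have := hD v₀
    omega
  have hnbrs : ∀ v ∈ K, K.erase v ∪ I.filter (G.Adj v ·) = G.nbrs v := by
    intro v hv
    refine eq_of_subset_of_card_le (hsub v hv) ?_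
    rw [hcardU v hv]
    have := hIadj v (hKI' v hv)
    have := hD v
    omega
  refine hcol (hcards.1 ▸ colorable_of_clique_of_indep hI hKI ?_
    (fun v hv => hIadj v (hKI' v hv)) (fun v hv w hw hw' hvw => ?_) fun i hi => ?_)
  · have := two_mul_card_le hD h2
    rw [hcards.2] at this
    omega
  · rw [← mem_nbrs, ← hnbrs v hv] at hvw
    rcases mem_union.1 hvw with h | h
    · exact hw (mem_of_mem_erase h)
    · exact hw' (mem_filter.1 h).1
  · by_contra! hall
    have hiK : i ∉ K := fun h => hKI' i h hi
    refine hcl (insert i K) ?_ (hcolD.mono ?_)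
    · rw [coe_insert]
      exact hK.insert fun b hb _ => hall b hb
    · rw [card_insert_of_notMem hiK]
      omega

end SimpleGraph

theorem IndFree.edgeTwoFree {V : Type*} {G : SimpleGraph V} (h : IndFree graphR G) :
    G.EdgeTwoFree := by
  intro a b c d hab hcd hcd' hac had hbc hbd
  have hca : c ≠ a := by
    rintro rfl
    exact hbc hab.symm
  have hcb : c ≠ b := by
    rintro rfl
    exact hac hab
  have hda : d ≠ a := by
    rintro rfl
    exact hbd hab.symm
  have hdb : d ≠ b := by
    rintro rfl
    exact had hab
  refine h.false ⟨⟨![a, b, c, d], ?_⟩, ?_⟩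
  · intro i j hij
    fin_cases i <;> fin_cases j <;> simp_all [hab.ne, hab.ne', eq_comm]
  · intro i j
    change G.Adj (![a, b, c, d] i) (![a, b, c, d] j) ↔ _
    have := G.adj_comm
    fin_cases i <;> fin_cases j <;> simp_all [graphR]

end

/-- A minimal `(K₂ ∪ 2K₁)`-free counterexample `G` to Borodin–Kostochka (i.e. `Δ(G) ≥ 9`,
`χ(G) > max {ω(G), Δ(G) - 1}`, with the fewest vertices among all such graphs) satisfies
`ω(G) = Δ(G) - 1`, and every vertex lying in a maximum clique has degree `Δ(G)`. -/
theorem minimal_counterexample_K2_union_2K1_free_cliqueNum {V : Type*} [Fintype V]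
    (G : SimpleGraph V)
    (hfree : IndFree graphR G) (hΔ : 9 ≤ maxDeg G)
    (hχ : ((max G.cliqueNum (maxDeg G - 1) : ℕ) : ℕ∞) < G.chromaticNumber)
    (hmin : ∀ (m : ℕ) (G' : SimpleGraph (Fin m)), IndFree graphR G' → 9 ≤ maxDeg G' →
      ((max G'.cliqueNum (maxDeg G' - 1) : ℕ) : ℕ∞) < G'.chromaticNumber →
      Fintype.card V ≤ m) :
    G.cliqueNum = maxDeg G - 1 ∧
      ∀ u : V, (∃ s : Finset V, G.IsNClique G.cliqueNum s ∧ u ∈ s) →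
        deg G u = maxDeg G := by
  exfalso
  have hD : ∀ v, (G.nbrs v).card ≤ maxDeg G := by
    classical
    intro v
    have h := G.degree_le_maxDegree v
    rw [← card_neighborFinset_eq_degree] at h
    convert h using 2
    · ext w
      simp [mem_nbrs]
    · rfl
  rcases hfree.edgeTwoFree.colorable_pred_or_exists_clique hD hΔ with h | ⟨s, hs, h⟩
  · exact absurd hχ (not_lt.2 (h.mono (le_max_right _ _)).chromaticNumber_le)
  · exact absurd hχ
      (not_lt.2 (h.mono (hs.card_le_cliqueNum.trans (le_max_left _ _))).chromaticNumber_le)
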